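/- arXiv:math/0503603 — 5 statements merged into one kernel-verified Lean document; each statement's English description precedes it below -/
import Mathlib

section
/- Let P be a finite set of points in ℝ² and r > 0. Let G_r be the graph with vertex set P and an edge between each pair of distinct points at Euclidean distance at most r. Suppose G_r is disconnected and every point of P has another point of P within distance r (no connected component of G_r is a singleton). Then there exists x ∈ P with |x| > r/2 such that (P ∖ {x}) ∩ S(x;r) ≠ ∅ and no point of P ∖ {x} lies in S(x;r) ∩ {y ∈ ℝ² : |y| < |x|}. (Such a point is obtained by taking, in each connected component, a vertex of minimal Euclidean norm; points of minimal norm in two distinct components cannot both have norm ≤ r/2, since otherwise they would be within distance r of each other.) -/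
open MeasureTheory ProbabilityTheory Filter Real
open scoped ENNReal NNReal

noncomputable section

/-- The plane `ℝ²` with the Euclidean norm. -/
abbrev Plane := EuclideanSpace ℝ (Fin 2)

/-- `μₙ⁽¹⁾(A, r) = n ∫_A e^{-n F(S(x;r))} dF(x)`. -/
def mu1 (F : Measure Plane) (n : ℕ) (A : Set Plane) (r : ℝ) : ℝ :=
  n * ∫ x in A, Real.exp (-(n : ℝ) * (F (Metric.closedBall x r)).toReal) ∂F

/-- `μₙ⁽²⁾(A, r) = n² ∫_A ∫_A 1{r < |x-y| ≤ 2r} e^{-n F(S(x;r) ∪ S(y;r))} dF(x) dF(y)`. -/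
def mu2 (F : Measure Plane) (n : ℕ) (A : Set Plane) (r : ℝ) : ℝ :=
  (n : ℝ) ^ 2 * ∫ x in A, ∫ y in A,
    (if r < dist x y ∧ dist x y ≤ 2 * r then
      Real.exp (-(n : ℝ) * (F (Metric.closedBall x r ∪ Metric.closedBall y r)).toReal)
     else 0) ∂F ∂F

/-- `μ̃ₙ⁽²⁾(A, r) = n² ∫_A ∫_A 1{|x-y| > r} e^{-n F(S(x;r) ∪ S(y;r))} dF(x) dF(y)`. -/
def mu2tilde (F : Measure Plane) (n : ℕ) (A : Set Plane) (r : ℝ) : ℝ :=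
  (n : ℝ) ^ 2 * ∫ x in A, ∫ y in A,
    (if r < dist x y then
      Real.exp (-(n : ℝ) * (F (Metric.closedBall x r ∪ Metric.closedBall y r)).toReal)
     else 0) ∂F ∂F

open Classical in
/-- `W_n(A, r)`: the number of indices `1 ≤ i ≤ N ω` with `X i ω ∈ A` and `X i ω`
`r`-separate, i.e. at distance `> r` from every other point `X j ω`, `1 ≤ j ≤ N ω`, `j ≠ i`. -/
def W {Ω : Type*} (X : ℕ → Ω → Plane) (N : Ω → ℕ) (A : Set Plane) (r : ℝ) (ω : Ω) : ℕ :=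
  ((Finset.Icc 1 (N ω)).filter (fun i => X i ω ∈ A ∧
    ∀ j ∈ Finset.Icc 1 (N ω), j ≠ i → r < dist (X i ω) (X j ω))).card

open Classical in
/-- The number of ordered pairs `(i, j)`, `1 ≤ i ≠ j ≤ N ω`, with both points in `A`,
both `r`-separate, and `|X i - X j| > r`. -/
def W2 {Ω : Type*} (X : ℕ → Ω → Plane) (N : Ω → ℕ) (A : Set Plane) (r : ℝ) (ω : Ω) : ℕ :=
  (((Finset.Icc 1 (N ω)) ×ˢ (Finset.Icc 1 (N ω))).filter (fun p => p.1 ≠ p.2 ∧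
    X p.1 ω ∈ A ∧ X p.2 ω ∈ A ∧
    (∀ j ∈ Finset.Icc 1 (N ω), j ≠ p.1 → r < dist (X p.1 ω) (X j ω)) ∧
    (∀ j ∈ Finset.Icc 1 (N ω), j ≠ p.2 → r < dist (X p.2 ω) (X j ω)) ∧
    r < dist (X p.1 ω) (X p.2 ω))).card

/-- `M_NNG(m)`: the longest nearest-neighbor edge on `X 1, …, X m`, as an extended real
(`⊤` for `m = 1`, `0` for `m = 0`). -/
def MNNG {Ω : Type*} (X : ℕ → Ω → Plane) (m : ℕ) (ω : Ω) : ℝ≥0∞ :=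
  ⨆ i ∈ Finset.Icc 1 m, ⨅ j ∈ (Finset.Icc 1 m).erase i, edist (X i ω) (X j ω)

/-- The graph on `X 1, …, X m` with an edge between each pair of points at distance `≤ r`
is connected. -/
def graphConnected {Ω : Type*} (X : ℕ → Ω → Plane) (m : ℕ) (r : ℝ) (ω : Ω) : Prop :=
  ∀ i ∈ Finset.Icc 1 m, ∀ j ∈ Finset.Icc 1 m,
    Relation.ReflTransGen
      (fun a b => a ∈ Finset.Icc 1 m ∧ b ∈ Finset.Icc 1 m ∧ dist (X a ω) (X b ω) ≤ r) i j

/-- `M_conn(m) = inf {r > 0 : the graph G_r on X 1, …, X m is connected}`, the longest edge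
of the Euclidean minimal spanning tree on `X 1, …, X m`. -/
def Mconn {Ω : Type*} (X : ℕ → Ω → Plane) (m : ℕ) (ω : Ω) : ℝ≥0∞ :=
  ⨅ r ∈ {r : ℝ | 0 < r ∧ graphConnected X m r ω}, ENNReal.ofReal r

/-- The point of `ℝ²` with coordinates `(a, b)`. -/
def pt (a b : ℝ) : Plane := (WithLp.equiv 2 (Fin 2 → ℝ)).symm ![a, b]


/-- A vertex of minimal norm in the component of `x` in the graph on `S` joining points at
distance at most `r`: none of its neighbours has smaller norm. -/
theorem exists_reflTransGen_norm_le_of_dist_le {E : Type*} [SeminormedAddCommGroup E]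
    {S : Finset E} (r : ℝ) {x : E} (hx : x ∈ S) :
    ∃ z ∈ S, Relation.ReflTransGen (fun a b => a ∈ S ∧ b ∈ S ∧ dist a b ≤ r) x z ∧
      ∀ y ∈ S, dist z y ≤ r → ‖z‖ ≤ ‖y‖ := by
  classical
  obtain ⟨z, hz, hmin⟩ := Finset.exists_min_image
    (S.filter (Relation.ReflTransGen (fun a b => a ∈ S ∧ b ∈ S ∧ dist a b ≤ r) x)) norm
    ⟨x, Finset.mem_filter.2 ⟨hx, .refl⟩⟩
  obtain ⟨hzS, hxz⟩ := Finset.mem_filter.1 hz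
  exact ⟨z, hzS, hxz, fun y hy hzy =>
    hmin y (Finset.mem_filter.2 ⟨hy, hxz.tail ⟨hzS, hy, hzy⟩⟩)⟩

theorem statement12
    (S : Finset Plane) (r : ℝ) (hr : 0 < r)
    (hdisc : ¬ ∀ x ∈ S, ∀ y ∈ S,
      Relation.ReflTransGen (fun a b => a ∈ S ∧ b ∈ S ∧ dist a b ≤ r) x y)
    (hnosingleton : ∀ x ∈ S, ∃ y ∈ S, y ≠ x ∧ dist x y ≤ r) :
    ∃ x ∈ S, r / 2 < ‖x‖ ∧
      (∃ y ∈ S, y ≠ x ∧ y ∈ Metric.closedBall x r) ∧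
      ∀ y ∈ S, y ≠ x → y ∈ Metric.closedBall x r → ¬ ‖y‖ < ‖x‖ := by
  have key : ∀ z ∈ S, (∀ y ∈ S, dist z y ≤ r → ‖z‖ ≤ ‖y‖) → r / 2 < ‖z‖ →
      ∃ x ∈ S, r / 2 < ‖x‖ ∧
        (∃ y ∈ S, y ≠ x ∧ y ∈ Metric.closedBall x r) ∧
        ∀ y ∈ S, y ≠ x → y ∈ Metric.closedBall x r → ¬ ‖y‖ < ‖x‖ := by
    intro z hz hmin hnorm
    obtain ⟨y, hy, hyz, hdist⟩ := hnosingleton z hz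
    exact ⟨z, hz, hnorm, ⟨y, hy, hyz, Metric.mem_closedBall'.2 hdist⟩,
      fun w hw _ hwz => (hmin w hw (Metric.mem_closedBall'.1 hwz)).not_gt⟩
  by_contra hcon
  refine hdisc fun x hx y hy => ?_
  obtain ⟨u, hu, hxu, humin⟩ := exists_reflTransGen_norm_le_of_dist_le r hx
  obtain ⟨v, hv, hyv, hvmin⟩ := exists_reflTransGen_norm_le_of_dist_le r hy
  have hu2 : ‖u‖ ≤ r / 2 := not_lt.1 fun h => hcon (key u hu humin h)
  have hv2 : ‖v‖ ≤ r / 2 := not_lt.1 fun h => hcon (key v hv hvmin h)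
  have huv : dist u v ≤ r := by linarith [dist_le_norm_add_norm u v]
  have hvy : Relation.ReflTransGen (fun a b => a ∈ S ∧ b ∈ S ∧ dist a b ≤ r) v y := by
    have : Std.Symm (fun a b : Plane => a ∈ S ∧ b ∈ S ∧ dist a b ≤ r) :=
      ⟨fun a b h => ⟨h.2.1, h.1, dist_comm a b ▸ h.2.2⟩⟩
    exact Relation.ReflTransGen.stdSymm.symm _ _ hyv
  exact (hxu.tail ⟨hu, hv, huv⟩).trans hvy

end
end

section
/- For every ξ > 0, r > 0 and ζ ∈ (−1, 1], ∫_{{v ∈ ℝ² : |v| ≤ r, v₂ ≤ ζ r}} e^{−ξ v₂} dv = 2 ξ^{−2} ∫_{−ξ r}^{ξ ζ r} e^{−v} ((ξ r)² − v²)^{1/2} dv = 2 ξ^{−2} e^{ξ r} (2 ξ r)^{1/2} ∫_0^{ξ(1+ζ) r} e^{−z} z^{1/2} (1 − z/(2 ξ r))^{1/2} dz, where the leftmost integral is with respect to two-dimensional Lebesgue measure and v₂ denotes the second coordinate of v. -/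
open MeasureTheory ProbabilityTheory Filter Real
open scoped ENNReal NNReal

noncomputable section

/-- The coordinates of a point of the plane, as a pair. -/
theorem measurePreserving_plane_coords :
    MeasurePreserving (fun v : Plane => (v 0, v 1)) volume volume :=
  (volume_preserving_finTwoArrow ℝ).comp (PiLp.volume_preserving_ofLp (Fin 2))

theorem measurableEmbedding_plane_coords :
    MeasurableEmbedding (fun v : Plane => (v 0, v 1)) :=
  (MeasurableEquiv.finTwoArrow (α := ℝ)).measurableEmbedding.comp
    (MeasurableEquiv.toLp 2 (Fin 2 → ℝ)).symm.measurableEmbedding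

/-- Integration over a disk truncated by a horizontal line, one horizontal chord at a time. -/
theorem setIntegral_truncated_disk {g : ℝ → ℝ} (hg : Continuous g) {r h : ℝ} (hr : 0 ≤ r)
    (h₁ : -r ≤ h) (h₂ : h ≤ r) :
    ∫ v in {v : Plane | ‖v‖ ≤ r ∧ v 1 ≤ h}, g (v 1)
      = ∫ y in (-r)..h, g y * (2 * √(r ^ 2 - y ^ 2)) := by
  set s : Set (ℝ × ℝ) := {p | p.1 ^ 2 + p.2 ^ 2 ≤ r ^ 2 ∧ p.2 ≤ h} with hs
  have hpre : {v : Plane | ‖v‖ ≤ r ∧ v 1 ≤ h} = (fun v : Plane => (v 0, v 1)) ⁻¹' s := by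
    ext v
    simp only [hs, Set.mem_ofPred_eq, Set.mem_preimage]
    rw [EuclideanSpace.norm_eq, Real.sqrt_le_left hr]
    simp [Fin.sum_univ_two]
  have hclosed : IsClosed s := by
    have hdisk : IsClosed {p : ℝ × ℝ | p.1 ^ 2 + p.2 ^ 2 ≤ r ^ 2} :=
      isClosed_le (by fun_prop) (by fun_prop)
    have hhalf : IsClosed {p : ℝ × ℝ | p.2 ≤ h} := isClosed_le (by fun_prop) (by fun_prop)
    exact hdisk.inter hhalf
  have hcompact : IsCompact s := by
    refine (isCompact_Icc.prod isCompact_Icc).of_isClosed_subset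
      (s := Set.Icc (-r) r ×ˢ Set.Icc (-r) r) hclosed ?_
    rintro ⟨x, y⟩ ⟨hxy, -⟩
    exact ⟨abs_le.mp (abs_le_of_sq_le_sq (by nlinarith [sq_nonneg y]) hr),
      abs_le.mp (abs_le_of_sq_le_sq (by nlinarith [sq_nonneg x]) hr)⟩
  have hint : Integrable (s.indicator fun p : ℝ × ℝ => g p.2) (volume.prod volume) := by
    rw [integrable_indicator_iff hclosed.measurableSet]
    exact (hg.comp continuous_snd).continuousOn.integrableOn_compact hcompact
  rw [hpre, measurePreserving_plane_coords.setIntegral_preimage_emb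
    measurableEmbedding_plane_coords (fun p : ℝ × ℝ => g p.2) s,
    ← integral_indicator hclosed.measurableSet, Measure.volume_eq_prod,
    integral_prod_symm _ hint, intervalIntegral.integral_of_le h₁,
    ← integral_Icc_eq_integral_Ioc, ← integral_indicator measurableSet_Icc]
  refine integral_congr_ae (ae_of_all _ fun y => ?_)
  by_cases hy : y ∈ Set.Icc (-r) h
  · have hnn : 0 ≤ r ^ 2 - y ^ 2 := by nlinarith [hy.1, hy.2]
    have hslice : (fun x => s.indicator (fun p : ℝ × ℝ => g p.2) (x, y))
        = (Set.Icc (-√(r ^ 2 - y ^ 2)) √(r ^ 2 - y ^ 2)).indicator fun _ => g y := by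
      funext x
      refine Set.indicator_eq_indicator ?_ rfl
      rw [Set.mem_Icc, ← Real.sq_le hnn]
      simp only [hs, Set.mem_ofPred_eq, hy.2, and_true]
      constructor <;> intro <;> linarith
    rw [Set.indicator_of_mem hy]
    simp only [hslice]
    rw [integral_indicator measurableSet_Icc, setIntegral_const, measureReal_def,
      Real.volume_Icc, ENNReal.toReal_ofReal (by linarith [Real.sqrt_nonneg (r ^ 2 - y ^ 2)]),
      smul_eq_mul]
    ring
  · have hslice : ∀ x, (x, y) ∉ s := by
      rintro x ⟨hxy, hyh⟩
      exact hy ⟨(abs_le.mp (abs_le_of_sq_le_sq (by nlinarith [sq_nonneg x]) hr)).1, hyh⟩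
    simp [hy, hslice]

theorem statement14
    (ξ r ζ : ℝ) (hξ : 0 < ξ) (hr : 0 < r) (hζ₁ : -1 < ζ) (hζ₂ : ζ ≤ 1) :
    (∫ v in {v : Plane | ‖v‖ ≤ r ∧ v 1 ≤ ζ * r}, Real.exp (-ξ * v 1) ∂volume)
      = 2 * (ξ ^ 2)⁻¹ *
        ∫ v in (-(ξ * r))..(ξ * ζ * r), Real.exp (-v) * Real.sqrt ((ξ * r) ^ 2 - v ^ 2) ∧
    (2 * (ξ ^ 2)⁻¹ *
        ∫ v in (-(ξ * r))..(ξ * ζ * r), Real.exp (-v) * Real.sqrt ((ξ * r) ^ 2 - v ^ 2))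
      = 2 * (ξ ^ 2)⁻¹ * Real.exp (ξ * r) * Real.sqrt (2 * ξ * r) *
        ∫ z in (0 : ℝ)..(ξ * (1 + ζ) * r),
          Real.exp (-z) * Real.sqrt z * Real.sqrt (1 - z / (2 * ξ * r)) := by
  have hξr : 0 < ξ * r := mul_pos hξ hr
  constructor
  · rw [setIntegral_truncated_disk (g := fun y => Real.exp (-ξ * y)) (by fun_prop) hr.le
      (by nlinarith) (by nlinarith)]
    have hscale := intervalIntegral.mul_integral_comp_mul_left (a := -r) (b := ζ * r)
      (f := fun v => Real.exp (-v) * √((ξ * r) ^ 2 - v ^ 2)) ξ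
    rw [show ξ * -r = -(ξ * r) by ring, show ξ * (ζ * r) = ξ * ζ * r by ring] at hscale
    rw [← hscale, ← intervalIntegral.integral_const_mul, ← intervalIntegral.integral_const_mul]
    refine intervalIntegral.integral_congr fun y _ => ?_
    have hsqrt : √((ξ * r) ^ 2 - (ξ * y) ^ 2) = ξ * √(r ^ 2 - y ^ 2) := by
      rw [show (ξ * r) ^ 2 - (ξ * y) ^ 2 = ξ ^ 2 * (r ^ 2 - y ^ 2) by ring,
        Real.sqrt_mul (sq_nonneg ξ), Real.sqrt_sq hξ.le]
    simp only [hsqrt, neg_mul]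
    field_simp
  · have hshift := intervalIntegral.integral_comp_sub_right (a := 0) (b := ξ * (1 + ζ) * r)
      (fun v => Real.exp (-v) * √((ξ * r) ^ 2 - v ^ 2)) (ξ * r)
    rw [zero_sub, show ξ * (1 + ζ) * r - ξ * r = ξ * ζ * r by ring] at hshift
    rw [← hshift, mul_assoc (2 * (ξ ^ 2)⁻¹), mul_assoc (2 * (ξ ^ 2)⁻¹),
      ← intervalIntegral.integral_const_mul (Real.exp (ξ * r) * √(2 * ξ * r))]
    congr 1
    refine intervalIntegral.integral_congr fun z hz => ?_
    rw [Set.uIcc_of_le (by nlinarith [mul_pos hξr (by linarith : 0 < 1 + ζ)])] at hz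
    have hsqrt : √((ξ * r) ^ 2 - (z - ξ * r) ^ 2)
        = √(2 * ξ * r) * (√z * √(1 - z / (2 * ξ * r))) := by
      rw [← Real.sqrt_mul hz.1, ← Real.sqrt_mul (by linarith)]
      congr 1
      field_simp
      ring
    simp only [hsqrt]
    rw [show -(z - ξ * r) = ξ * r + -z by ring, Real.exp_add]
    ring

end
end

section
/- For every T > 0 and every s with 0 < s ≤ 2T, √π/2 − (3√π/4)·(1/s + 1/(4T)) ≤ ∫_0^s e^{−z} z^{1/2} (1 − z/(2T))^{1/2} dz ≤ √π/2. (Here √π/2 = Γ(3/2) and 3√π/4 = Γ(5/2).) -/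
open MeasureTheory ProbabilityTheory Filter Real
open scoped ENNReal NNReal

noncomputable section

lemma integrableOn_exp_neg_mul_sqrt :
    IntegrableOn (fun z : ℝ => Real.exp (-z) * Real.sqrt z) (Set.Ioi 0) := by
  refine (Real.GammaIntegral_convergent (s := 3 / 2) (by norm_num)).congr_fun
    (fun z _ => ?_) measurableSet_Ioi
  simp only [Real.sqrt_eq_rpow]
  norm_num

lemma integral_exp_neg_mul_sqrt :
    ∫ z in Set.Ioi (0 : ℝ), Real.exp (-z) * Real.sqrt z = Real.sqrt π / 2 := by
  have h := Real.Gamma_eq_integral (s := 3 / 2) (by norm_num)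
  have h' := Real.Gamma_add_one (s := 1 / 2) (by norm_num)
  rw [Real.Gamma_one_half_eq, show (1 / 2 + 1 : ℝ) = 3 / 2 by norm_num, h] at h'
  norm_num at h'
  simp only [Real.sqrt_eq_rpow] at h' ⊢
  norm_num at h' ⊢
  linarith

lemma exp_neg_mul_sqrt_mul_self {z : ℝ} (hz : 0 < z) :
    Real.exp (-z) * z ^ ((5 / 2 : ℝ) - 1) = Real.exp (-z) * Real.sqrt z * z := by
  rw [show (5 / 2 : ℝ) - 1 = 1 / 2 + 1 by norm_num, Real.rpow_add_one hz.ne',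
    Real.sqrt_eq_rpow, mul_assoc]

lemma integrableOn_exp_neg_mul_sqrt_mul_self :
    IntegrableOn (fun z : ℝ => Real.exp (-z) * Real.sqrt z * z) (Set.Ioi 0) :=
  (Real.GammaIntegral_convergent (s := 5 / 2) (by norm_num)).congr_fun
    (fun _ hz => exp_neg_mul_sqrt_mul_self hz) measurableSet_Ioi

lemma integral_exp_neg_mul_sqrt_mul_self :
    ∫ z in Set.Ioi (0 : ℝ), Real.exp (-z) * Real.sqrt z * z = 3 * Real.sqrt π / 4 := by
  rw [← setIntegral_congr_fun measurableSet_Ioi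
    (fun _ hz => exp_neg_mul_sqrt_mul_self hz),
    ← Real.Gamma_eq_integral (s := 5 / 2) (by norm_num),
    show (5 / 2 : ℝ) = 1 / 2 + 1 + 1 by norm_num, Real.Gamma_add_one (by norm_num),
    Real.Gamma_add_one (by norm_num), Real.Gamma_one_half_eq]
  ring

lemma one_sub_le_sqrt_one_sub {u : ℝ} (h₀ : 0 ≤ u) (h₁ : u ≤ 1) :
    1 - u ≤ Real.sqrt (1 - u) :=
  Real.le_sqrt_of_sq_le (by nlinarith)

theorem statement15
    (T s : ℝ) (hT : 0 < T) (hs : 0 < s) (hsT : s ≤ 2 * T) :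
    Real.sqrt π / 2 - (3 * Real.sqrt π / 4) * (1 / s + 1 / (4 * T)) ≤
      (∫ z in (0 : ℝ)..s, Real.exp (-z) * Real.sqrt z * Real.sqrt (1 - z / (2 * T))) ∧
    (∫ z in (0 : ℝ)..s, Real.exp (-z) * Real.sqrt z * Real.sqrt (1 - z / (2 * T))) ≤
      Real.sqrt π / 2 := by
  have hf : IntegrableOn (fun z : ℝ =>
      Real.exp (-z) * Real.sqrt z * Real.sqrt (1 - z / (2 * T))) (Set.Ioc 0 s) :=
    (Continuous.integrableOn_Icc (by fun_prop)).mono_set Set.Ioc_subset_Icc_self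
  have hi := integrableOn_exp_neg_mul_sqrt
  have hi' := integrableOn_exp_neg_mul_sqrt_mul_self
  rw [intervalIntegral.integral_of_le hs.le]
  constructor
  · have hg : IntegrableOn (fun z : ℝ => Real.exp (-z) * Real.sqrt z -
        Real.exp (-z) * Real.sqrt z * z / s) (Set.Ioi 0) := hi.sub (hi'.div_const s)
    have hval : ∫ z in Set.Ioi (0 : ℝ), (Real.exp (-z) * Real.sqrt z -
        Real.exp (-z) * Real.sqrt z * z / s) =
        Real.sqrt π / 2 - 3 * Real.sqrt π / 4 / s := by
      rw [integral_sub hi (hi'.div_const s), integral_div, integral_exp_neg_mul_sqrt,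
        integral_exp_neg_mul_sqrt_mul_self]
    have hsub : Set.Ioi s ⊆ Set.Ioi 0 := Set.Ioi_subset_Ioi hs.le
    rw [← Set.Ioc_union_Ioi_eq_Ioi hs.le, setIntegral_union Set.Ioc_disjoint_Ioi_same
      measurableSet_Ioi (hg.mono_set Set.Ioc_subset_Ioi_self) (hg.mono_set hsub)] at hval
    have htail : ∫ z in Set.Ioi s, (Real.exp (-z) * Real.sqrt z -
        Real.exp (-z) * Real.sqrt z * z / s) ≤ 0 := by
      refine setIntegral_nonpos measurableSet_Ioi fun z hz => ?_
      have hz1 : 1 ≤ z / s := (one_le_div hs).2 (le_of_lt hz)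
      have hp : 0 ≤ Real.exp (-z) * Real.sqrt z := by positivity
      rw [mul_div_assoc]
      nlinarith
    have hmain : ∫ z in Set.Ioc 0 s, (Real.exp (-z) * Real.sqrt z -
        Real.exp (-z) * Real.sqrt z * z / s) ≤
        ∫ z in Set.Ioc 0 s, Real.exp (-z) * Real.sqrt z * Real.sqrt (1 - z / (2 * T)) := by
      refine setIntegral_mono_on (hg.mono_set Set.Ioc_subset_Ioi_self) hf measurableSet_Ioc
        fun z hz => ?_
      have hz0 : 0 ≤ z := hz.1.le
      have hle : z / (2 * T) ≤ z / s := by gcongr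
      have h1 : z / (2 * T) ≤ 1 := hle.trans ((div_le_one hs).2 hz.2)
      have h2 := one_sub_le_sqrt_one_sub (u := z / (2 * T)) (by positivity) h1
      calc Real.exp (-z) * Real.sqrt z - Real.exp (-z) * Real.sqrt z * z / s
          = Real.exp (-z) * Real.sqrt z * (1 - z / s) := by ring
        _ ≤ _ := by
          gcongr
          linarith
    have hpos : 0 ≤ 3 * Real.sqrt π / 4 * (1 / (4 * T)) := by positivity
    have hexp : 3 * Real.sqrt π / 4 * (1 / s + 1 / (4 * T)) =
        3 * Real.sqrt π / 4 / s + 3 * Real.sqrt π / 4 * (1 / (4 * T)) := by ring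
    linarith
  · rw [← integral_exp_neg_mul_sqrt]
    calc ∫ z in Set.Ioc 0 s, Real.exp (-z) * Real.sqrt z * Real.sqrt (1 - z / (2 * T))
        ≤ ∫ z in Set.Ioc 0 s, Real.exp (-z) * Real.sqrt z := by
          refine setIntegral_mono_on hf (hi.mono_set Set.Ioc_subset_Ioi_self)
            measurableSet_Ioc fun z hz => mul_le_of_le_one_right (by positivity) ?_
          have hu : 0 ≤ z / (2 * T) := div_nonneg hz.1.le (by positivity)
          exact Real.sqrt_le_one.2 (by linarith)
      _ ≤ _ := setIntegral_mono_set hi (ae_of_all _ fun z => by positivity)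
          Set.Ioc_subset_Ioi_self.eventuallyLE

end
end

section
/- There exists a constant c ∈ (0, 1) such that for every r > 0 and every x ∈ ℝ² with |x| > r/2, the two-dimensional Lebesgue measure of S(x;r) ∩ S(0;|x|) is at least c·π·r², where 0 denotes the origin of ℝ². -/
open MeasureTheory ProbabilityTheory Filter Real
open scoped ENNReal NNReal

noncomputable section

/-- A ball of radius `ρ ≤ ‖x‖` internally tangent to `closedBall 0 ‖x‖` at `x` lies in the
intersection of that ball with `closedBall x (2 * ρ)`. -/
lemma closedBall_smul_subset_inter_closedBall {E : Type*} [NormedAddCommGroup E]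
    [NormedSpace ℝ E] {x : E} {ρ : ℝ} (hρ : 0 < ρ) (hx : ρ ≤ ‖x‖) :
    Metric.closedBall ((1 - ρ / ‖x‖) • x) ρ ⊆
      Metric.closedBall x (2 * ρ) ∩ Metric.closedBall 0 ‖x‖ := by
  have hx0 : 0 < ‖x‖ := hρ.trans_le hx
  have hle : ρ / ‖x‖ ≤ 1 := (div_le_one hx0).2 hx
  refine Set.subset_inter (Metric.closedBall_subset_closedBall' ?_)
    (Metric.closedBall_subset_closedBall' ?_)
  · have h : (1 - ρ / ‖x‖) • x - x = -((ρ / ‖x‖) • x) := by module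
    rw [dist_eq_norm, h, norm_neg, norm_smul, Real.norm_of_nonneg (by positivity),
      div_mul_cancel₀ _ hx0.ne']
    linarith
  · rw [dist_zero_right, norm_smul, Real.norm_of_nonneg (by linarith), sub_mul,
      div_mul_cancel₀ _ hx0.ne']
    linarith

theorem statement16 :
    ∃ c : ℝ, 0 < c ∧ c < 1 ∧ ∀ r : ℝ, 0 < r → ∀ x : Plane, r / 2 < ‖x‖ →
      c * π * r ^ 2 ≤
        (volume (Metric.closedBall x r ∩ Metric.closedBall (0 : Plane) ‖x‖)).toReal := by
  refine ⟨1 / 4, by norm_num, by norm_num, fun r hr x hx => ?_⟩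
  have hsub := closedBall_smul_subset_inter_closedBall (half_pos hr) hx.le
  rw [mul_div_cancel₀ r two_ne_zero] at hsub
  have hfin : volume (Metric.closedBall x r ∩ Metric.closedBall (0 : Plane) ‖x‖) ≠ ⊤ :=
    measure_ne_top_of_subset Set.inter_subset_left measure_closedBall_lt_top.ne
  refine le_trans (le_of_eq ?_) (ENNReal.toReal_mono hfin (measure_mono hsub))
  rw [EuclideanSpace.volume_closedBall_fin_two, ENNReal.toReal_mul, ENNReal.toReal_pow,
    ENNReal.toReal_ofReal (half_pos hr).le, ENNReal.toReal_ofReal pi_nonneg]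
  ring

end
end

section
/- Let α > 0, y₀ > 0, and let a : [y₀, ∞) → ℝ be continuously differentiable with α + a(y) > 0 for all y ≥ y₀, a(y) → 0 and y·a'(y) → 0 as y → ∞. Define ω(u) = u^α exp( ∫_{y₀}^u a(y)/y dy ) for u ≥ y₀. Then: (i) ω'(u)/ω(u) = (α + a(u))/u for all u > y₀; (ii) ω''(u)/ω'(u) = (α − 1 + ã(u))/u where ã(u) = a(u) + u a'(u)/(α + a(u)), and ã(u) → 0 as u → ∞; (iii) lim_{u → ∞} ( |ω''(u)|/ω'(u)³ + 1/(ω(u) ω'(u)) ) · ( ω'(u) log u )² = 0. -/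
open MeasureTheory ProbabilityTheory Filter Real
open scoped ENNReal NNReal

noncomputable section

/-- Over `(y₀, ∞)`, a function of the form `u ^ α * exp (∫ a y / y)` with `a` continuous on
`[y₀, ∞)` has logarithmic derivative `(α + a u) / u`. -/
lemma hasDerivAt_rpow_mul_exp_integral {α y₀ u : ℝ} (hy₀ : 0 < y₀) {a : ℝ → ℝ}
    (ha : ContinuousOn a (Set.Ici y₀)) (hu : y₀ < u) :
    HasDerivAt (fun u : ℝ => u ^ α * Real.exp (∫ y in y₀..u, a y / y))
      (u ^ α * Real.exp (∫ y in y₀..u, a y / y) * ((α + a u) / u)) u := by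
  have hu0 : 0 < u := hy₀.trans hu
  have hc : ContinuousOn (fun y => a y / y) (Set.Ici y₀) :=
    ha.div continuousOn_id fun y hy => (hy₀.trans_le hy).ne'
  have hint : IntervalIntegrable (fun y => a y / y) volume y₀ u :=
    (hc.mono (by rw [Set.uIcc_of_le hu.le]; exact Set.Icc_subset_Ici_self)).intervalIntegrable
  have hmeas : StronglyMeasurableAtFilter (fun y => a y / y) (nhds u) volume :=
    (hc.mono Set.Ioi_subset_Ici_self).stronglyMeasurableAtFilter isOpen_Ioi u hu
  have hI := intervalIntegral.integral_hasDerivAt_right hint hmeas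
    (hc.continuousAt (Ici_mem_nhds hu))
  have hp := Real.hasDerivAt_rpow_const (p := α) (Or.inl hu0.ne')
  refine (hp.mul hI.exp).congr_deriv ?_
  rw [Real.rpow_sub_one hu0.ne']
  field_simp

/-- If `g` has a finite limit at infinity, then `g u / u * (log u) ^ 2` tends to zero. -/
lemma tendsto_div_mul_log_sq_zero {g : ℝ → ℝ} {c : ℝ} (hg : Tendsto g atTop (nhds c)) :
    Tendsto (fun u => g u / u * Real.log u ^ 2) atTop (nhds 0) := by
  have hlog : Tendsto (fun u : ℝ => Real.log u ^ 2 / u) atTop (nhds 0) :=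
    (isLittleO_pow_log_id_atTop (n := 2)).tendsto_div_nhds_zero
  have h := hg.mul hlog
  rw [mul_zero] at h
  refine h.congr fun u => ?_
  ring

theorem statement19
    (α y₀ : ℝ) (hα : 0 < α) (hy₀ : 0 < y₀)
    (a : ℝ → ℝ) (ha : ContDiffOn ℝ 1 a (Set.Ici y₀))
    (hpos : ∀ y, y₀ ≤ y → 0 < α + a y)
    (ha0 : Tendsto a atTop (nhds 0))
    (ha1 : Tendsto (fun y => y * deriv a y) atTop (nhds 0))
    (ω : ℝ → ℝ)
    (hω : ∀ u : ℝ, ω u = u ^ α * Real.exp (∫ y in y₀..u, a y / y)) :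
    (∀ u : ℝ, y₀ < u → deriv ω u / ω u = (α + a u) / u) ∧
    (∀ u : ℝ, y₀ < u → deriv (deriv ω) u / deriv ω u =
      (α - 1 + (a u + u * deriv a u / (α + a u))) / u) ∧
    Tendsto (fun u => a u + u * deriv a u / (α + a u)) atTop (nhds 0) ∧
    Tendsto (fun u =>
      (|deriv (deriv ω) u| / (deriv ω u) ^ 3 + 1 / (ω u * deriv ω u)) *
        (deriv ω u * Real.log u) ^ 2) atTop (nhds 0) := by
  have hωpos : ∀ u, y₀ < u → 0 < ω u := fun u hu => by
    rw [hω]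
    exact mul_pos (Real.rpow_pos_of_pos (hy₀.trans hu) _) (Real.exp_pos _)
  have hd : ∀ u, y₀ < u → HasDerivAt ω (ω u * ((α + a u) / u)) u := fun u hu => by
    rw [funext hω]
    exact hasDerivAt_rpow_mul_exp_integral hy₀ ha.continuousOn hu
  have hd'pos : ∀ u, y₀ < u → 0 < deriv ω u := fun u hu => by
    rw [(hd u hu).deriv]
    exact mul_pos (hωpos u hu) (div_pos (hpos u hu.le) (hy₀.trans hu))
  have h₁ : ∀ u : ℝ, y₀ < u → deriv ω u / ω u = (α + a u) / u := fun u hu => by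
    rw [(hd u hu).deriv, mul_div_cancel_left₀ _ (hωpos u hu).ne']
  have h₂ : ∀ u : ℝ, y₀ < u → deriv (deriv ω) u / deriv ω u =
      (α - 1 + (a u + u * deriv a u / (α + a u))) / u := fun u hu => by
    have hu0 : u ≠ 0 := (hy₀.trans hu).ne'
    have hw := (hωpos u hu).ne'
    have hp := (hpos u hu.le).ne'
    have haD : HasDerivAt a (deriv a u) u :=
      ((ha.contDiffAt (Ici_mem_nhds hu)).differentiableAt one_ne_zero).hasDerivAt
    have heq : deriv ω =ᶠ[nhds u] fun v => ω v * ((α + a v) / v) := by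
      filter_upwards [Ioi_mem_nhds hu] with v hv using (hd v hv).deriv
    have hq := (hd u hu).mul ((haD.const_add α).div (hasDerivAt_id u) hu0)
    rw [(hq.congr_of_eventuallyEq heq).deriv, (hd u hu).deriv]
    simp only [id, Pi.div_apply]
    field_simp
    ring
  have h₃ : Tendsto (fun u => a u + u * deriv a u / (α + a u)) atTop (nhds 0) := by
    have h := ha0.add (ha1.div (ha0.const_add α) (by simpa using hα.ne'))
    simpa using h
  refine ⟨h₁, h₂, h₃, ?_⟩
  have hlim := (tendsto_div_mul_log_sq_zero (h₃.const_add (α - 1)).abs).add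
    (tendsto_div_mul_log_sq_zero (ha0.const_add α))
  rw [add_zero] at hlim
  refine hlim.congr' ?_
  filter_upwards [eventually_gt_atTop y₀] with u hu
  have hw := (hωpos u hu).ne'
  have hd' := hd'pos u hu
  have hu0 : 0 < u := hy₀.trans hu
  have habs : |α - 1 + (a u + u * deriv a u / (α + a u))| / u
      = |deriv (deriv ω) u| / deriv ω u := by
    have h := congrArg abs (h₂ u hu)
    rw [abs_div, abs_div, abs_of_pos hd', abs_of_pos hu0] at h
    exact h.symm
  rw [habs, ← h₁ u hu]
  have hd'' := hd'.ne'
  field_simp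

end
end
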